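/- Let p be an odd prime, G a finite p-group, and V a faithful 𝔽_p G-module such that no non-identity element of Ω₁(Z(G)) is quadratic on V. If A is an abelian normal subgroup of G, then A contains no offender: there is no nontrivial elementary abelian subgroup E ≤ A with |E|·|C_V(E)| ≥ |V|. -/

import Mathlib

open Polynomial

section Defs

variable (p : ℕ) {G V : Type*} [Group G] [AddCommGroup V] [Module (ZMod p) V]

/-- The fixed-point subspace `C_V(H)` of a subgroup `H ≤ G`. -/
def fixedPts (ρ : Representation (ZMod p) G V) (H : Subgroup G) :
    Submodule (ZMod p) V where
  carrier := {v | ∀ h ∈ H, ρ h v = v}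
  add_mem' := by
    intro a b ha hb h hh
    simp [map_add, ha h hh, hb h hh]
  zero_mem' := by
    intro h hh
    simp
  smul_mem' := by
    intro c v hv h hh
    simp [map_smul, hv h hh]

/-- `E` is an elementary abelian `p`-subgroup. -/
def IsElemAbelian (E : Subgroup G) : Prop :=
  (∀ x ∈ E, x ^ p = 1) ∧ ∀ x ∈ E, ∀ y ∈ E, x * y = y * x

/-- `E` is an offender of `G` on `V`. -/
def IsOffender (ρ : Representation (ZMod p) G V) (E : Subgroup G) : Prop :=
  E ≠ ⊥ ∧ IsElemAbelian p E ∧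
    Nat.card V ≤ Nat.card E * Nat.card (fixedPts p ρ E)

/-- `j_H(V) = |H|·|C_V(H)|/|V|`. -/
noncomputable def jval (ρ : Representation (ZMod p) G V) (H : Subgroup G) : ℚ :=
  ((Nat.card H : ℚ) * (Nat.card (fixedPts p ρ H) : ℚ)) / (Nat.card V : ℚ)

/-- A non-identity element `g` is quadratic on `V`: `(g-1)² = 0` on `V`. -/
def IsQuadElt (ρ : Representation (ZMod p) G V) (g : G) : Prop :=
  g ≠ 1 ∧ (ρ g - 1) ^ 2 = 0

/-- `[V,E,E] = 0`. -/
def IsQuadSubgroup (ρ : Representation (ZMod p) G V) (E : Subgroup G) : Prop :=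
  ∀ e ∈ E, ∀ f ∈ E, (ρ e - 1) * (ρ f - 1) = 0

/-- The set `𝒫(G,V)` of best offenders. -/
def bestOffenders (ρ : Representation (ZMod p) G V) : Set (Subgroup G) :=
  {E | E ≠ ⊥ ∧ IsElemAbelian p E ∧
    ∀ F : Subgroup G, F ≤ E → jval p ρ F ≤ jval p ρ E}

end Defs

section Offenders

variable {p : ℕ} {G V : Type*} [Group G] [AddCommGroup V] [Module (ZMod p) V]

lemma fixedPts_anti (ρ : Representation (ZMod p) G V) {H K : Subgroup G} (h : H ≤ K) :
    fixedPts p ρ K ≤ fixedPts p ρ H := fun _ hv x hx => hv x (h hx)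

lemma fixedPts_sup (ρ : Representation (ZMod p) G V) (H K : Subgroup G) :
    fixedPts p ρ (H ⊔ K) = fixedPts p ρ H ⊓ fixedPts p ρ K := by
  refine le_antisymm
    (le_inf (fixedPts_anti ρ le_sup_left) (fixedPts_anti ρ le_sup_right)) ?_
  rintro v ⟨hH, hK⟩
  let S : Subgroup G :=
    { carrier := {g | ρ g v = v}
      one_mem' := by simp
      mul_mem' := by
        intro a b ha hb
        simp only [Set.mem_ofPred_eq] at ha hb ⊢
        rw [map_mul, Module.End.mul_apply, hb, ha]
      inv_mem' := by
        intro a ha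
        simp only [Set.mem_ofPred_eq] at ha ⊢
        nth_rewrite 1 [← ha]
        exact ρ.inv_self_apply a v }
  have hS : H ⊔ K ≤ S := sup_le hH hK
  exact fun x hx => hS hx

lemma fixedPts_bot (ρ : Representation (ZMod p) G V) : fixedPts p ρ ⊥ = ⊤ := by
  refine top_unique fun v _ h hh => ?_
  rw [Subgroup.mem_bot.1 hh, map_one, Module.End.one_apply]

/-- The numerator `|H|·|C_V(H)|` of `jval`. -/
noncomputable def jnum (ρ : Representation (ZMod p) G V) (H : Subgroup G) : ℕ :=
  Nat.card H * Nat.card (fixedPts p ρ H)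

lemma jnum_bot (ρ : Representation (ZMod p) G V) : jnum ρ ⊥ = Nat.card V := by
  simp [jnum, fixedPts_bot]

lemma Subgroup.card_mul_card_le_card_sup_mul_card_inf [Finite G] (H K : Subgroup G) :
    Nat.card H * Nat.card K ≤ Nat.card ↥(H ⊔ K) * Nat.card ↥(H ⊓ K) := by
  have h1 : Nat.card ↥(H ⊓ K) * K.relIndex H = Nat.card H := by
    have := Subgroup.relIndex_mul_relIndex ⊥ (H ⊓ K) H bot_le inf_le_left
    rwa [Subgroup.relIndex_bot_left, Subgroup.relIndex_bot_left, Subgroup.inf_relIndex_left]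
      at this
  have h2 : Nat.card K * K.relIndex (H ⊔ K) = Nat.card ↥(H ⊔ K) := by
    have := Subgroup.relIndex_mul_relIndex ⊥ K (H ⊔ K) bot_le le_sup_right
    rwa [Subgroup.relIndex_bot_left, Subgroup.relIndex_bot_left] at this
  have h3 : K.relIndex H ≤ K.relIndex (H ⊔ K) :=
    Subgroup.relIndex_le_of_le_right le_sup_left Subgroup.FiniteIndex.index_ne_zero
  rw [← h1, ← h2]
  calc _ = (Nat.card ↥(H ⊓ K) * Nat.card K) * K.relIndex H := by ring
    _ ≤ (Nat.card ↥(H ⊓ K) * Nat.card K) * K.relIndex (H ⊔ K) := Nat.mul_le_mul_left _ h3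
    _ = _ := by ring

lemma Submodule.card_sup_mul_card_inf {K M : Type*} [Field K] [AddCommGroup M] [Module K M]
    [Module.Finite K M] (S T : Submodule K M) :
    Nat.card ↥(S ⊔ T) * Nat.card ↥(S ⊓ T) = Nat.card S * Nat.card T := by
  rw [Module.natCard_eq_pow_finrank (K := K) (V := S),
    Module.natCard_eq_pow_finrank (K := K) (V := T),
    Module.natCard_eq_pow_finrank (K := K) (V := ↥(S ⊔ T)),
    Module.natCard_eq_pow_finrank (K := K) (V := ↥(S ⊓ T)), ← pow_add, ← pow_add,
    Submodule.finrank_sup_add_finrank_inf_eq]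

lemma Submodule.eq_of_le_of_card_le {K M : Type*} [Ring K] [AddCommGroup M] [Module K M]
    [Finite M] {S T : Submodule K M} (h : S ≤ T) (hc : Nat.card T ≤ Nat.card S) : S = T :=
  SetLike.coe_injective (Set.eq_of_subset_of_ncard_le h hc (Set.toFinite _))

lemma fixedPts_sup_le_inf (ρ : Representation (ZMod p) G V) (H K : Subgroup G) :
    fixedPts p ρ H ⊔ fixedPts p ρ K ≤ fixedPts p ρ (H ⊓ K) :=
  sup_le (fixedPts_anti ρ inf_le_left) (fixedPts_anti ρ inf_le_right)

/-- `H` maximizes `jnum` among the subgroups of `A`. -/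
def IsJMax (ρ : Representation (ZMod p) G V) (A H : Subgroup G) : Prop :=
  H ≤ A ∧ ∀ K ≤ A, jnum ρ K ≤ jnum ρ H

lemma IsJMax.of_jnum_le {ρ : Representation (ZMod p) G V} {A H K : Subgroup G}
    (hH : IsJMax ρ A H) (hK : K ≤ A) (h : jnum ρ H ≤ jnum ρ K) : IsJMax ρ A K :=
  ⟨hK, fun L hL => (hH.2 L hL).trans h⟩

lemma exists_isJMax [Finite G] (ρ : Representation (ZMod p) G V) (A : Subgroup G) :
    ∃ H, IsJMax ρ A H := by
  obtain ⟨H, hH, hmax⟩ := Set.exists_max_image {H : Subgroup G | H ≤ A} (jnum ρ)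
    (Set.toFinite _) ⟨A, le_refl A⟩
  exact ⟨H, hH, hmax⟩

/-- A `p`-group acting nontrivially on `V` stabilizes a proper subspace that contains both its
fixed points and its commutators. -/
lemma exists_proper_submodule_commutator [Fact p.Prime] [Finite V]
    {ρ : Representation (ZMod p) G V} {F : Subgroup G}
    (hF : IsPGroup p F) (hne : fixedPts p ρ F ≠ ⊤) :
    ∃ W : Submodule (ZMod p) V, W ≠ ⊤ ∧ fixedPts p ρ F ≤ W ∧
      ∀ f ∈ F, ∀ v, ρ f v - v ∈ W := by
  let D := (fixedPts p ρ F).dualAnnihilator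
  let act : MulAction F D :=
    { smul := fun f φ => ⟨φ.1 ∘ₗ ρ (f : G)⁻¹, by
        refine (Submodule.mem_dualAnnihilator _).2 fun w hw => ?_
        have h1 := hw _ (inv_mem f.2)
        rw [LinearMap.comp_apply, h1]
        exact (Submodule.mem_dualAnnihilator _).1 φ.2 w hw⟩
      one_smul := fun φ => Subtype.ext (LinearMap.ext fun v =>
        show φ.1 (ρ ((1 : F) : G)⁻¹ v) = φ.1 v by simp)
      mul_smul := fun f g φ => Subtype.ext (LinearMap.ext fun v =>
        show φ.1 (ρ ((f * g : F) : G)⁻¹ v) = φ.1 (ρ (g : G)⁻¹ (ρ (f : G)⁻¹ v)) by simp) }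
  have hD : D ≠ ⊥ := fun h => hne (by
    rw [← Subspace.dualAnnihilator_dualCoannihilator_eq (W := fixedPts p ρ F)]
    change D.dualCoannihilator = ⊤
    rw [h, Submodule.dualCoannihilator_bot])
  have : Nontrivial D := Submodule.nontrivial_iff_ne_bot.2 hD
  have : Finite D := Module.finite_of_finite (ZMod p)
  have hcard : p ∣ Nat.card D := by
    rw [Module.natCard_eq_pow_finrank (K := ZMod p), Nat.card_zmod]
    exact dvd_pow_self p Module.finrank_pos.ne'
  obtain ⟨φ, hφ, hφ0⟩ := hF.exists_fixed_point_of_prime_dvd_card_of_fixed_point D hcard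
    (a := 0) (fun f => Subtype.ext (LinearMap.ext fun v => rfl))
  refine ⟨LinearMap.ker φ.1, fun h => hφ0 (Subtype.ext (LinearMap.ker_eq_top.1 h).symm),
    fun w hw => (Submodule.mem_dualAnnihilator _).1 φ.2 w hw, fun f hf v => ?_⟩
  have h1 : φ.1 (ρ ((⟨f⁻¹, inv_mem hf⟩ : F) : G)⁻¹ v) = φ.1 v :=
    LinearMap.congr_fun (congrArg Subtype.val (hφ ⟨f⁻¹, inv_mem hf⟩)) v
  rw [LinearMap.mem_ker, map_sub, sub_eq_zero]
  simpa using h1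

/-- The elements of `F` fixing every commutator `[v, f]` with `v ∈ s`, `f ∈ F`. -/
def commCentralizer (ρ : Representation (ZMod p) G V) (F : Subgroup G) (s : Set V) :
    Subgroup G where
  carrier := {b | b ∈ F ∧ ∀ v ∈ s, ∀ f ∈ F, ρ b (ρ f v - v) = ρ f v - v}
  one_mem' := ⟨one_mem F, fun v _ f _ => by simp⟩
  mul_mem' := by
    rintro a b ⟨ha, ha'⟩ ⟨hb, hb'⟩
    refine ⟨mul_mem ha hb, fun v hv f hf => ?_⟩
    rw [map_mul, Module.End.mul_apply, hb' v hv f hf, ha' v hv f hf]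
  inv_mem' := by
    rintro a ⟨ha, ha'⟩
    refine ⟨inv_mem ha, fun v hv f hf => ?_⟩
    nth_rewrite 1 [← ha' v hv f hf]
    exact ρ.inv_self_apply a _

lemma commCentralizer_le (ρ : Representation (ZMod p) G V) (F : Subgroup G) (s : Set V) :
    commCentralizer ρ F s ≤ F := fun _ h => h.1

lemma commCentralizer_insert (ρ : Representation (ZMod p) G V) (F : Subgroup G) (v : V)
    (s : Set V) : commCentralizer ρ F (insert v s) =
      commCentralizer ρ F {v} ⊓ commCentralizer ρ F s := by
  ext b
  constructor
  · rintro ⟨hb, h⟩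
    refine ⟨⟨hb, ?_⟩, hb, fun w hw => h w (Set.mem_insert_of_mem _ hw)⟩
    rintro w rfl
    exact h w (Set.mem_insert _ _)
  · rintro ⟨⟨hb, h⟩, -, h'⟩
    refine ⟨hb, ?_⟩
    rintro w (rfl | hw)
    · exact h w rfl
    · exact h' w hw

lemma commCentralizer_univ_normal (ρ : Representation (ZMod p) G V) {F : Subgroup G}
    (hF : F.Normal) : (commCentralizer ρ F Set.univ).Normal := by
  refine ⟨?_⟩
  rintro b ⟨hb, h⟩ g
  refine ⟨hF.conj_mem b hb g, fun v _ f hf => ?_⟩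
  have h1 := h (ρ g⁻¹ v) trivial (g⁻¹ * f * g) (by simpa using hF.conj_mem f hf g⁻¹)
  have h2 : ρ (g⁻¹ * f * g) (ρ g⁻¹ v) - ρ g⁻¹ v = ρ g⁻¹ (ρ f v - v) := by
    simp [map_mul]
  rw [h2] at h1
  rw [map_mul, map_mul, Module.End.mul_apply, Module.End.mul_apply, h1]
  exact ρ.self_inv_apply g _

lemma jnum_le_jnum_conj [Finite V] (ρ : Representation (ZMod p) G V) (H : Subgroup G) (g : G) :
    jnum ρ H ≤ jnum ρ (H.map (MulAut.conj g).toMonoidHom) := by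
  unfold jnum
  refine Nat.mul_le_mul (Subgroup.card_map_of_injective (MulAut.conj g).injective).ge ?_
  refine Nat.card_le_card_of_injective
    (fun v : fixedPts p ρ H => (⟨ρ g v, ?_⟩ :
      fixedPts p ρ (H.map (MulAut.conj g).toMonoidHom))) ?_
  · rintro _ ⟨h, hh, rfl⟩
    have := v.2 h hh
    simp [this]
  · intro v w hvw
    have h : ρ g v = ρ g w := congrArg Subtype.val hvw
    exact Subtype.ext ((ρ.apply_bijective g).injective h)

section

variable [Fact p.Prime] [Finite G] [Finite V]

lemma jnum_pos (ρ : Representation (ZMod p) G V) (H : Subgroup G) : 0 < jnum ρ H :=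
  Nat.mul_pos Nat.card_pos Nat.card_pos

lemma jnum_mul_le (ρ : Representation (ZMod p) G V) (H K : Subgroup G) :
    jnum ρ H * jnum ρ K ≤ jnum ρ (H ⊔ K) *
      (Nat.card ↥(H ⊓ K) * Nat.card ↥(fixedPts p ρ H ⊔ fixedPts p ρ K)) := by
  have h1 := Subgroup.card_mul_card_le_card_sup_mul_card_inf H K
  have h2 := Submodule.card_sup_mul_card_inf (fixedPts p ρ H) (fixedPts p ρ K)
  unfold jnum
  rw [fixedPts_sup]
  calc _ = (Nat.card H * Nat.card K) *
        (Nat.card (fixedPts p ρ H) * Nat.card (fixedPts p ρ K)) := by ring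
    _ ≤ (Nat.card ↥(H ⊔ K) * Nat.card ↥(H ⊓ K)) *
        (Nat.card (fixedPts p ρ H) * Nat.card (fixedPts p ρ K)) := Nat.mul_le_mul_right _ h1
    _ = _ := by rw [← h2]; ring

lemma IsJMax.sup {ρ : Representation (ZMod p) G V} {A H K : Subgroup G}
    (hH : IsJMax ρ A H) (hK : IsJMax ρ A K) : IsJMax ρ A (H ⊔ K) := by
  refine hH.of_jnum_le (sup_le hH.1 hK.1) ?_
  have h := jnum_mul_le ρ H K
  have h1 : Nat.card ↥(H ⊓ K) * Nat.card ↥(fixedPts p ρ H ⊔ fixedPts p ρ K) ≤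
      jnum ρ (H ⊓ K) :=
    Nat.mul_le_mul_left _ (Nat.card_mono (Set.toFinite _) (fixedPts_sup_le_inf ρ H K))
  have h2 := hK.2 _ (inf_le_left.trans hH.1 : H ⊓ K ≤ A)
  exact Nat.le_of_mul_le_mul_right (h.trans (Nat.mul_le_mul_left _ (h1.trans h2)))
    (jnum_pos ρ K)

lemma IsJMax.inf {ρ : Representation (ZMod p) G V} {A H K : Subgroup G}
    (hH : IsJMax ρ A H) (hK : IsJMax ρ A K) :
    IsJMax ρ A (H ⊓ K) ∧ fixedPts p ρ (H ⊓ K) = fixedPts p ρ H ⊔ fixedPts p ρ K := by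
  have hle : H ⊓ K ≤ A := inf_le_left.trans hH.1
  have h := jnum_mul_le ρ H K
  have h1 := fixedPts_sup_le_inf ρ H K
  have h2 := hH.2 _ (sup_le hH.1 hK.1)
  have h3 : jnum ρ K ≤
      Nat.card ↥(H ⊓ K) * Nat.card ↥(fixedPts p ρ H ⊔ fixedPts p ρ K) :=
    Nat.le_of_mul_le_mul_left (h.trans (Nat.mul_le_mul_right _ h2)) (jnum_pos ρ H)
  refine ⟨hK.of_jnum_le hle
    (h3.trans (Nat.mul_le_mul_left _ (Nat.card_mono (Set.toFinite _) h1))), ?_⟩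
  exact (Submodule.eq_of_le_of_card_le h1
    (Nat.le_of_mul_le_mul_left ((hK.2 _ hle).trans h3) Nat.card_pos)).symm

lemma exists_greatest_isJMax (ρ : Representation (ZMod p) G V) (A : Subgroup G) :
    ∃ F, IsJMax ρ A F ∧ ∀ H, IsJMax ρ A H → H ≤ F := by
  obtain ⟨H₀, h₀⟩ := exists_isJMax ρ A
  obtain ⟨F, hF⟩ := (Set.toFinite {H : Subgroup G | IsJMax ρ A H}).exists_maximal ⟨H₀, h₀⟩
  exact ⟨F, hF.1, fun H hH => le_sup_right.trans (hF.2 (hF.1.sup hH) le_sup_left)⟩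

lemma normal_of_greatest_isJMax {ρ : Representation (ZMod p) G V} {A F : Subgroup G}
    (hA : A.Normal) (hF : IsJMax ρ A F) (hmax : ∀ H, IsJMax ρ A H → H ≤ F) : F.Normal := by
  refine ⟨fun n hn g => ?_⟩
  refine hmax (F.map (MulAut.conj g).toMonoidHom) (hF.of_jnum_le ?_ (jnum_le_jnum_conj ρ F g))
    ⟨n, hn, rfl⟩
  rintro _ ⟨h, hh, rfl⟩
  exact hA.conj_mem h (hF.1 hh) g

/-- The counting step of Timmesfeld's replacement theorem. -/
lemma jnum_le_card_mul_card {ρ : Representation (ZMod p) G V} {F : Subgroup G}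
    (hab : ∀ a ∈ F, ∀ b ∈ F, a * b = b * a) {W : Submodule (ZMod p) V}
    (hCW : fixedPts p ρ F ≤ W) (hW : ∀ f ∈ F, ∀ v, ρ f v - v ∈ W) (v : V) :
    jnum ρ F ≤ Nat.card (commCentralizer ρ F {v}) *
      Nat.card ↥(fixedPts p ρ (commCentralizer ρ F {v}) ⊓ W) := by
  classical
  set B := commCentralizer ρ F {v}
  let C := fixedPts p ρ B ⊓ W
  have hC : ∀ x : F × fixedPts p ρ F, ρ (x.1 : G) v - v + x.2 ∈ C := fun x =>
    ⟨add_mem (fun b hb => hb.2 v rfl _ x.1.2)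
      (fixedPts_anti ρ (commCentralizer_le ρ F {v}) x.2.2),
      add_mem (hW _ x.1.2 v) (hCW x.2.2)⟩
  let q : F × fixedPts p ρ F → C := fun x => ⟨_, hC x⟩
  have key : ∀ x y, q x = q y → (x.1 : G) * (y.1 : G)⁻¹ ∈ B := by
    intro x y hxy
    have hxy' : ρ (x.1 : G) v - v + x.2 = ρ (y.1 : G) v - v + y.2 := congrArg Subtype.val hxy
    have hmem : (x.1 : G) * (y.1 : G)⁻¹ ∈ F := mul_mem x.1.2 (inv_mem y.1.2)
    refine ⟨hmem, ?_⟩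
    rintro w rfl f hf
    have hcomm : (x.1 : G) * (y.1 : G)⁻¹ = (y.1 : G)⁻¹ * (x.1 : G) :=
      hab _ x.1.2 _ (inv_mem y.1.2)
    have hd : ((y.2 : V) - x.2) ∈ fixedPts p ρ F := sub_mem y.2.2 x.2.2
    have h1 : ρ (x.1 : G) w = ρ (y.1 : G) w + ((y.2 : V) - x.2) := by
      rw [← sub_eq_zero] at hxy' ⊢
      rw [← hxy']; abel
    have h2 : ρ ((x.1 : G) * (y.1 : G)⁻¹) w = w + ((y.2 : V) - x.2) := by
      rw [hcomm, map_mul, Module.End.mul_apply, h1, map_add, ρ.inv_self_apply,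
        hd _ (inv_mem y.1.2)]
    have h3 : ρ ((x.1 : G) * (y.1 : G)⁻¹) (ρ f w) = ρ f w + ((y.2 : V) - x.2) := by
      rw [← Module.End.mul_apply, ← map_mul, hab _ hmem _ hf, map_mul, Module.End.mul_apply,
        h2, map_add, hd _ hf]
    rw [map_sub, h2, h3]
    abel
  have := Fintype.ofFinite F
  have := Fintype.ofFinite (fixedPts p ρ F)
  have := Fintype.ofFinite C
  have hmain := Finset.card_le_mul_card_image_of_maps_to (f := q) (s := Finset.univ)
    (t := Finset.univ) (fun _ _ => Finset.mem_univ _) (Nat.card B) (by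
      intro c _
      rcases Finset.eq_empty_or_nonempty {a ∈ Finset.univ | q a = c} with h | ⟨y, hy⟩
      · rw [h]; simp
      rw [Finset.mem_filter] at hy
      rw [← Nat.card_eq_finsetCard]
      refine Nat.card_le_card_of_injective (fun x : {x // x ∈ Finset.univ.filter (q · = c)} =>
        (⟨(x.1.1 : G) * (y.1 : G)⁻¹,
          key _ _ ((Finset.mem_filter.1 x.2).2.trans hy.2.symm)⟩ : B)) ?_
      rintro ⟨x, hx⟩ ⟨z, hz⟩ hxz
      have h1 : (x.1 : G) = z.1 := mul_right_cancel (congrArg Subtype.val hxz)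
      have h2 : ρ (x.1 : G) v - v + x.2 = ρ (z.1 : G) v - v + z.2 :=
        congrArg Subtype.val ((Finset.mem_filter.1 hx).2.trans (Finset.mem_filter.1 hz).2.symm)
      rw [h1] at h2
      exact Subtype.ext (Prod.ext (Subtype.ext h1) (Subtype.ext (add_left_cancel h2))))
  rwa [Finset.card_univ, Finset.card_univ, ← Nat.card_eq_fintype_card,
    ← Nat.card_eq_fintype_card, Nat.card_prod] at hmain

lemma isJMax_commCentralizer {ρ : Representation (ZMod p) G V} {A F : Subgroup G}
    (hab : ∀ a ∈ F, ∀ b ∈ F, a * b = b * a) (hF : IsJMax ρ A F) {W : Submodule (ZMod p) V}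
    (hCW : fixedPts p ρ F ≤ W) (hW : ∀ f ∈ F, ∀ v, ρ f v - v ∈ W) (s : Set V) :
    IsJMax ρ A (commCentralizer ρ F s) ∧ fixedPts p ρ (commCentralizer ρ F s) ≤ W := by
  induction s, Set.toFinite s using Set.Finite.induction_on with
  | empty =>
    have : commCentralizer ρ F ∅ = F :=
      le_antisymm (commCentralizer_le ρ F ∅) fun b hb => ⟨hb, fun v hv => hv.elim⟩
    rw [this]
    exact ⟨hF, hCW⟩
  | @insert v s _ _ ih =>
    have h1 := jnum_le_card_mul_card hab hCW hW v
    have hle : commCentralizer ρ F {v} ≤ A := (commCentralizer_le ρ F {v}).trans hF.1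
    have hmax : IsJMax ρ A (commCentralizer ρ F {v}) := hF.of_jnum_le hle
      (h1.trans (Nat.mul_le_mul_left _ (Nat.card_mono (Set.toFinite _) inf_le_left)))
    have heq : fixedPts p ρ (commCentralizer ρ F {v}) ⊓ W =
        fixedPts p ρ (commCentralizer ρ F {v}) :=
      Submodule.eq_of_le_of_card_le inf_le_left
        (Nat.le_of_mul_le_mul_left ((hF.2 _ hle).trans h1) Nat.card_pos)
    rw [commCentralizer_insert]
    obtain ⟨h2, h3⟩ := hmax.inf ih.1
    exact ⟨h2, h3 ▸ sup_le (inf_eq_left.1 heq) ih.2⟩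

lemma IsPGroup.exists_mem_center_of_normal {B : Subgroup G} (hG : IsPGroup p G)
    (hB : B.Normal) (hne : B ≠ ⊥) : ∃ g ∈ B, g ∈ Subgroup.center G ∧ g ^ p = 1 ∧ g ≠ 1 := by
  have hBp : IsPGroup p B := hG.to_subgroup B
  have hdvd : p ∣ Nat.card B := hBp.card_eq_or_dvd.resolve_left
    fun h => hne (Subgroup.card_eq_one.1 h)
  obtain ⟨b, hb, hb1⟩ := IsPGroup.exists_fixed_point_of_prime_dvd_card_of_fixed_point
    (hG.of_equiv ConjAct.toConjAct) B hdvd (a := 1) (fun g => smul_one g)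
  have hbc : (b : G) ∈ B ⊓ Subgroup.center G := by
    refine ⟨b.2, Subgroup.mem_center_iff.2 fun g => ?_⟩
    have h : g * b * g⁻¹ = b := congrArg Subtype.val (hb (ConjAct.toConjAct g))
    rwa [mul_inv_eq_iff_eq_mul] at h
  have hdvd' : p ∣ Nat.card ↥(B ⊓ Subgroup.center G) :=
    (hG.to_subgroup (B ⊓ Subgroup.center G)).card_eq_or_dvd.resolve_left fun h =>
      hb1 (Subtype.ext (by
        rw [Subgroup.card_eq_one.1 h] at hbc
        exact (Subgroup.mem_bot.1 hbc).symm))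
  obtain ⟨g, hg⟩ := exists_prime_orderOf_dvd_card' p hdvd'
  refine ⟨g, g.2.1, g.2.2, ?_, fun h => ?_⟩
  · rw [← hg, ← Subgroup.orderOf_coe, pow_orderOf_eq_one]
  · rw [← Subgroup.orderOf_coe, h, orderOf_one] at hg
    exact (Fact.out : p.Prime).one_lt.ne hg

end

end Offenders

/-- **Theorem (no offenders in abelian normal subgroups).** Let `p` be an odd prime, `G` a
finite `p`-group and `V` a faithful `𝔽_p G`-module such that no non-identity element of
`Ω₁(Z(G))` is quadratic on `V`.  If `A` is an abelian normal subgroup of `G`, then `A`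
contains no offender. -/
theorem stmt5 {p : ℕ} (hp : p.Prime) (hodd : Odd p) {G V : Type*} [Group G] [Finite G]
    [AddCommGroup V] [Module (ZMod p) V] [Finite V]
    (hG : IsPGroup p G) (ρ : Representation (ZMod p) G V)
    (hfaithful : Function.Injective ρ)
    (hnoquad : ∀ g ∈ Subgroup.center G, g ^ p = 1 → ¬ IsQuadElt p ρ g)
    (A : Subgroup G) (hA : A.Normal)
    (hAab : ∀ a ∈ A, ∀ b ∈ A, a * b = b * a) :
    ¬ ∃ E : Subgroup G, E ≤ A ∧ IsOffender p ρ E := by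
  have : Fact p.Prime := ⟨hp⟩
  rintro ⟨E, hEA, hE1, -, hE⟩
  obtain ⟨F, hF, hmax⟩ := exists_greatest_isJMax ρ A
  have hFab : ∀ a ∈ F, ∀ b ∈ F, a * b = b * a := fun a ha b hb =>
    hAab a (hF.1 ha) b (hF.1 hb)
  have hF1 : F ≠ ⊥ := by
    rintro rfl
    exact hE1 (le_bot_iff.1 (hmax E (hF.of_jnum_le hEA ((jnum_bot ρ).trans_le hE))))
  have hFC : fixedPts p ρ F ≠ ⊤ := fun h => hF1 ((Subgroup.eq_bot_iff_forall F).2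
    fun f hf => hfaithful (by
      rw [map_one]
      exact LinearMap.ext fun v => (h ▸ Submodule.mem_top : v ∈ fixedPts p ρ F) f hf))
  obtain ⟨W, hWtop, hCW, hW⟩ := exists_proper_submodule_commutator (hG.to_subgroup F) hFC
  have hB1 : commCentralizer ρ F Set.univ ≠ ⊥ := by
    intro h
    have h1 := (isJMax_commCentralizer hFab hF hCW hW Set.univ).2
    rw [h, fixedPts_bot] at h1
    exact hWtop (top_unique h1)
  obtain ⟨g, hgB, hgZ, hgp, hg1⟩ := IsPGroup.exists_mem_center_of_normal hG
    (commCentralizer_univ_normal ρ (normal_of_greatest_isJMax hA hF hmax)) hB1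
  refine hnoquad g hgZ hgp ⟨hg1, LinearMap.ext fun v => ?_⟩
  have h := hgB.2 v trivial g hgB.1
  rw [pow_two, Module.End.mul_apply, LinearMap.sub_apply, LinearMap.sub_apply,
    Module.End.one_apply, Module.End.one_apply, h, sub_self, LinearMap.zero_apply]
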